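/- There exists ε₀ > 0 such that for every ε ∈ (0, ε₀) there exists ℓ₀ such that for every ℓ ≥ ℓ₀ there exists n₀ such that the following holds for all n ≥ n₀: if H is a 3-uniform hypergraph on n vertices that contains no pseudocycle of length m for any m ≤ ℓ with m not divisible by 3, then e(H) ≤ f(n) + εn³. -/

import Mathlib

/-- `f 0 = f 1 = 0` and, for `n ≥ 2`,
`f n = max over 1 ≤ k ≤ n − 1 of (k choose 2)·(n − k) + f (n − k)`
(here `k = j + 1` ranges over `1, …, n − 1`). -/
def f : ℕ → ℕ
  | 0 => 0
  | 1 => 0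
  | n + 2 =>
    (Finset.range (n + 1)).sup fun j =>
      Nat.choose (j + 1) 2 * (n + 1 - j) + f (n + 1 - j)
  decreasing_by omega
/-- `H` has a pseudocycle of length `ℓ`: a sequence of vertices indexed by `ZMod ℓ`
such that every three cyclically consecutive vertices form an edge of `H`. -/
def HasPseudocycle {V : Type} [DecidableEq V] (H : Finset (Finset V)) (ℓ : ℕ) : Prop :=
  ∃ v : ZMod ℓ → V, ∀ i : ZMod ℓ, ({v i, v (i + 1), v (i + 2)} : Finset V) ∈ H



set_option linter.unusedSectionVars false
theorem f_ge (k m : ℕ) (hk : 1 ≤ k) : Nat.choose k 2 * m + f m ≤ f (k + m) := by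
  rcases Nat.eq_zero_or_pos m with rfl | hm
  · simp [f]
  · obtain ⟨n, hn⟩ : ∃ n, k + m = n + 2 := ⟨k + m - 2, by omega⟩
    rw [hn, f]
    have h := Finset.le_sup (f := fun j => Nat.choose (j + 1) 2 * (n + 1 - j) + f (n + 1 - j))
      (s := Finset.range (n + 1)) (b := k - 1) (by simp; omega)
    have e1 : k - 1 + 1 = k := by omega
    have e2 : n + 1 - (k - 1) = m := by omega
    simp only [e1, e2] at h
    exact h

section weights
variable {ι : Type} [Fintype ι] [DecidableEq ι]

/-- blue indicator -/
def Bl (d : ι → ι → ZMod 3) (i j : ι) : ℤ := if d i j = 0 then 1 else 0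
/-- red indicator -/
def Rd (d : ι → ι → ZMod 3) (i j : ι) : ℤ := if d i j = 1 then 1 else 0

/-- twice the weighted number of good triples -/
def PP (d : ι → ι → ZMod 3) (w : ι → ℤ) : ℤ :=
  (∑ i, ∑ i', ∑ j, Bl d i i' * Rd d i j * Rd d i' j * (w i * w i' * w j))
    - ∑ i, ∑ j, Rd d i j * (w i * w j)

theorem PP_line (d : ι → ι → ZMod 3) (hd : ∀ i j, d j i = - d i j) (w : ι → ℤ)
    (x y : ι) (hxy : x ≠ y) (hb : d x y = 0) (hw : ∀ i, 0 ≤ w i) :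
    ∃ L Q : ℤ, 0 ≤ Q ∧ ∀ t : ℤ,
      PP d (fun i => w i + t * ((if i = x then 1 else 0) - (if i = y then 1 else 0)))
        = PP d w + t * L + t ^ 2 * Q := by
  have hb' : d y x = 0 := by rw [hd, hb]; rfl
  have hself : ∀ i, d i i = 0 := by
    intro i
    have h := hd i i
    revert h
    generalize d i i = a
    revert a
    decide
  set v : ι → ℤ := fun i => (if i = x then 1 else 0) - (if i = y then 1 else 0) with hv
  have hR : ∀ i j, Rd d i j * (v i * v j) = 0 := by
    intro i j
    clear hd
    simp only [hv, Rd]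
    by_cases h1 : i = x <;> by_cases h2 : i = y <;> by_cases h3 : j = x <;> by_cases h4 : j = y <;>
      simp_all
  refine ⟨(∑ i, ∑ i', ∑ j, Bl d i i' * Rd d i j * Rd d i' j *
      (v i * w i' * w j + w i * v i' * w j + w i * w i' * v j))
      - ∑ i, ∑ j, Rd d i j * (v i * w j + w i * v j),
    ∑ i, ∑ i', ∑ j, Bl d i i' * Rd d i j * Rd d i' j * (v i * v i' * w j), ?_, ?_⟩
  · have : ∑ i, ∑ i', ∑ j, Bl d i i' * Rd d i j * Rd d i' j * (v i * v i' * w j)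
        = ∑ j, w j * (Rd d x j - Rd d y j) ^ 2 := by
      have h1 : ∀ i i' j, Bl d i i' * Rd d i j * Rd d i' j * (v i * v i' * w j)
          = w j * ((Rd d i j * v i) * (Rd d i' j * v i')) := by
        intro i i' j
        have : Bl d i i' * (v i * v i') = v i * v i' := by
          clear hd
          simp only [hv, Bl]
          by_cases h1 : i = x <;> by_cases h2 : i = y <;> by_cases h3 : i' = x <;>
            by_cases h4 : i' = y <;> simp_all
        linear_combination (Rd d i j * Rd d i' j * w j) * this
      simp_rw [h1]
      have h2 : ∀ i, ∑ i', ∑ j, w j * ((Rd d i j * v i) * (Rd d i' j * v i'))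
         = ∑ j, ∑ i', w j * ((Rd d i j * v i) * (Rd d i' j * v i')) := fun i => Finset.sum_comm
      simp_rw [h2]
      rw [Finset.sum_comm]
      refine Finset.sum_congr rfl fun j _ => ?_
      have h3 : ∑ i, Rd d i j * v i = Rd d x j - Rd d y j := by
        simp [hv, mul_sub, Finset.sum_sub_distrib]
      simp_rw [← Finset.mul_sum, h3]
      rw [← Finset.sum_mul, h3, sq]
    rw [this]
    exact Finset.sum_nonneg fun j _ => mul_nonneg (hw j) (sq_nonneg _)
  · intro t
    have h1 : ∀ i i' j, Bl d i i' * Rd d i j * Rd d i' j *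
          ((w i + t * v i) * (w i' + t * v i') * (w j + t * v j))
        = Bl d i i' * Rd d i j * Rd d i' j * (w i * w i' * w j)
          + t * (Bl d i i' * Rd d i j * Rd d i' j *
            (v i * w i' * w j + w i * v i' * w j + w i * w i' * v j))
          + t ^ 2 * (Bl d i i' * Rd d i j * Rd d i' j * (v i * v i' * w j)) := by
      intro i i' j
      linear_combination (Bl d i i' * Rd d i' j * t ^ 2 * (w i' + t * v i')) * hR i j +
        (Bl d i i' * Rd d i j * t ^ 2 * w i) * hR i' j
    have h2 : ∀ i j, Rd d i j * ((w i + t * v i) * (w j + t * v j))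
        = Rd d i j * (w i * w j) + t * (Rd d i j * (v i * w j + w i * v j)) := by
      intro i j
      linear_combination t ^ 2 * hR i j
    change PP d (fun i => w i + t * v i) = _
    unfold PP
    simp_rw [h1, h2, Finset.sum_add_distrib, ← Finset.mul_sum]
    ring

theorem PP_noblue (d : ι → ι → ZMod 3) (hd : ∀ i j, d j i = - d i j) (w : ι → ℤ)
    (h : ∀ x y, x ≠ y → w x ≠ 0 → w y ≠ 0 → d x y ≠ 0) :
    PP d w = ∑ i, ∑ j, Rd d i j * ((w i ^ 2 - w i) * w j) := by
  have hself : ∀ i, d i i = 0 := by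
    intro i
    have h := hd i i
    revert h
    generalize d i i = a
    revert a
    decide
  unfold PP
  rw [← Finset.sum_sub_distrib]
  refine Finset.sum_congr rfl fun i _ => ?_
  have : ∑ i', ∑ j, Bl d i i' * Rd d i j * Rd d i' j * (w i * w i' * w j)
      = ∑ j, Rd d i j * (w i ^ 2 * w j) := by
    rw [Finset.sum_eq_single i]
    · refine Finset.sum_congr rfl fun j _ => ?_
      have : Rd d i j * Rd d i j = Rd d i j := by unfold Rd; split_ifs <;> rfl
      simp only [Bl, hself, if_true]
      linear_combination (w i ^ 2 * w j) * this
    · intro i' _ hne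
      refine Finset.sum_eq_zero fun j _ => ?_
      by_cases h1 : w i = 0
      · simp [h1]
      by_cases h2 : w i' = 0
      · simp [h2]
      simp [Bl, h i i' hne.symm h1 h2]
    · simp
  rw [this, ← Finset.sum_sub_distrib]
  refine Finset.sum_congr rfl fun j _ => ?_
  ring

theorem PP_le (d : ι → ι → ZMod 3) (hd : ∀ i j, d j i = - d i j) :
    ∀ (s : ℕ) (w : ι → ℕ), (Finset.univ.filter fun i => w i ≠ 0).card = s →
      PP d (fun i => (w i : ℤ)) ≤ 2 * (f (∑ i, w i) : ℤ) := by
  intro s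
  induction s using Nat.strong_induction_on with
  | _ s ih =>
  intro w hs
  by_cases hblue : ∃ x y, x ≠ y ∧ w x ≠ 0 ∧ w y ≠ 0 ∧ d x y = 0
  · obtain ⟨x, y, hxy, hx, hy, hb⟩ := hblue
    -- a move that empties `b` into `a`
    have key : ∀ a b : ι, a ≠ b → w a ≠ 0 → w b ≠ 0 → 
        PP d (fun i => (w i : ℤ) + (w b : ℤ) * ((if i = a then 1 else 0) - (if i = b then 1 else 0)))
          ≤ 2 * (f (∑ i, w i) : ℤ) := by
      intro a b hab ha hb
      let w' : ι → ℕ := fun i => if i = b then 0 else if i = a then w a + w b else w i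
      have e1 : (fun i => (w i : ℤ) + (w b : ℤ) *
          ((if i = a then 1 else 0) - (if i = b then 1 else 0))) = fun i => (w' i : ℤ) := by
        funext i
        by_cases h1 : i = b
        · subst h1; simp [w', hab.symm]
        · by_cases h2 : i = a
          · subst h2; simp [w', h1]
          · simp [w', h1, h2]
      have e2 : ∑ i, w' i = ∑ i, w i := by
        have : (∑ i, (w' i : ℤ)) = ∑ i, (w i : ℤ) := by
          have := congrArg (fun g : ι → ℤ => ∑ i, g i) e1
          rw [← this]
          simp [Finset.sum_add_distrib, ← Finset.mul_sum, Finset.sum_sub_distrib]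
        exact_mod_cast this
      rw [e1, ← e2]
      refine ih _ ?_ w' rfl
      rw [← hs]
      apply Finset.card_lt_card
      rw [Finset.ssubset_iff_of_subset]
      · exact ⟨b, by simp [hb], by simp [w']⟩
      · intro i
        simp only [Finset.mem_filter, Finset.mem_univ, true_and, w']
        by_cases h1 : i = b
        · simp [h1]
        · by_cases h2 : i = a
          · simp [h2, ha]
          · simp [h1, h2]
    obtain ⟨L, Q, hQ, hL⟩ := PP_line d hd (fun i => (w i : ℤ)) x y hxy hb (fun i => by positivity)
    rcases le_total 0 L with h | h
    · have h1 := key x y hxy hx hy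
      rw [hL] at h1
      nlinarith [mul_nonneg (Int.natCast_nonneg (w y)) h, mul_nonneg (sq_nonneg (w y : ℤ)) hQ]
    · have h1 := key y x hxy.symm hy hx
      have h2 := hL (-(w x : ℤ))
      have h3 : (fun i => (w i : ℤ) + -(w x : ℤ) *
          ((if i = x then 1 else 0) - (if i = y then 1 else 0))) = (fun i => (w i : ℤ) + (w x : ℤ) *
          ((if i = y then 1 else 0) - (if i = x then 1 else 0))) := by
        funext i; ring
      rw [h3] at h2
      rw [h2] at h1
      nlinarith [mul_nonneg (Int.natCast_nonneg (w x)) (neg_nonneg.2 h),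
        mul_nonneg (sq_nonneg (w x : ℤ)) hQ]
  · push Not at hblue
    have hnb : ∀ x y, x ≠ y → (w x : ℤ) ≠ 0 → (w y : ℤ) ≠ 0 → d x y ≠ 0 := by
      intro x y h1 h2 h3
      exact hblue x y h1 (by exact_mod_cast h2) (by exact_mod_cast h3)
    rw [PP_noblue d hd _ hnb]
    by_cases hz : ∀ i, w i = 0
    · simp [hz]
    push Not at hz
    obtain ⟨i1, hi1⟩ := hz
    obtain ⟨z, -, hz⟩ := Finset.exists_max_image Finset.univ w ⟨i1, Finset.mem_univ _⟩
    have hz0 : w z ≠ 0 := by have := hz i1 (Finset.mem_univ _); omega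
    let w' : ι → ℕ := fun i => if i = z then 0 else w i
    have hle : ∀ i, w' i ≠ 0 → w i ≠ 0 := by
      intro i; simp only [w']; split_ifs <;> simp
    have hih := ih _ (by
      rw [← hs]
      apply Finset.card_lt_card
      rw [Finset.ssubset_iff_of_subset]
      · exact ⟨z, by simp [hz0], by simp [w']⟩
      · intro i
        simp only [Finset.mem_filter, Finset.mem_univ, true_and]
        exact hle i) w' rfl
    rw [PP_noblue d hd _ (fun x y h1 h2 h3 => hblue x y h1 (hle x (by exact_mod_cast h2))
      (hle y (by exact_mod_cast h3)))] at hih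
    have hsum : ∑ i, w i = w z + ∑ i, w' i := by
      rw [← Finset.add_sum_erase _ _ (Finset.mem_univ z),
        ← Finset.add_sum_erase _ w' (Finset.mem_univ z)]
      simp only [w', if_true, zero_add]
      congr 1
      refine Finset.sum_congr rfl fun i hi => ?_
      simp [Finset.ne_of_mem_erase hi]
    have hf := f_ge (w z) (∑ i, w' i) (by omega)
    rw [← hsum] at hf
    have hch : 2 * ((w z).choose 2 : ℤ) = (w z : ℤ) ^ 2 - w z := by
      have h1 := Nat.choose_two_right (w z)
      have h2 : 2 ∣ w z * (w z - 1) := (Nat.even_mul_pred_self _).two_dvd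
      have h3 : 2 * (w z).choose 2 = w z * (w z - 1) := by omega
      obtain ⟨k, hk⟩ := Nat.exists_eq_succ_of_ne_zero hz0
      rw [hk] at h3 ⊢
      simp only [Nat.succ_eq_add_one, Nat.add_sub_cancel] at h3
      push_cast
      have : (2 * ((k + 1).choose 2 : ℤ)) = (k + 1) * k := by exact_mod_cast h3
      rw [this]; ring
    -- termwise bound
    have hself : Rd d z z = 0 := by
      have h := hd z z
      unfold Rd
      revert h
      generalize d z z = a
      revert a
      decide
    have hcols : ∀ i j, Rd d i j * (((w i : ℤ) ^ 2 - w i) * w j) =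
        Rd d i j * (((w' i : ℤ) ^ 2 - w' i) * w' j) +
        ((if i = z then Rd d z j * (((w z : ℤ) ^ 2 - w z) * w' j) else 0) +
        (if j = z then Rd d i z * (((w' i : ℤ) ^ 2 - w' i) * w z) else 0)) := by
      intro i j
      by_cases h1 : i = z <;> by_cases h2 : j = z <;> simp [w', h1, h2, hself]
    have hbd : ∀ j, Rd d z j * (((w z : ℤ) ^ 2 - w z) * w' j) +
        Rd d j z * (((w' j : ℤ) ^ 2 - w' j) * w z) ≤ ((w z : ℤ) ^ 2 - w z) * w' j := by
      intro j
      have hwz : (1 : ℤ) ≤ w z := by exact_mod_cast Nat.one_le_iff_ne_zero.2 hz0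
      have hj : (w' j : ℤ) ≤ w z := by
        have := hz j (Finset.mem_univ _)
        have : w' j ≤ w z := by simp only [w']; split_ifs <;> omega
        exact_mod_cast this
      have hj0 : (0 : ℤ) ≤ w' j := by positivity
      have hA : 0 ≤ ((w z : ℤ) ^ 2 - w z) * w' j := by
        apply mul_nonneg _ hj0; nlinarith
      have hB : (((w' j : ℤ) ^ 2 - w' j) * w z) ≤ ((w z : ℤ) ^ 2 - w z) * w' j := by
        nlinarith [mul_nonneg (mul_nonneg hj0 (by linarith : (0 : ℤ) ≤ w z)) (sub_nonneg.2 hj)]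
      have hdd := hd z j
      unfold Rd
      by_cases h1 : d z j = 1
      · have : d j z ≠ 1 := by rw [hdd, h1]; decide
        simp [h1, this]
      · by_cases h2 : d j z = 1
        · simp [h1, h2, hB]
        · simp [h1, h2, hA]
    simp_rw [hcols, Finset.sum_add_distrib]
    have s1 : ∑ i, ∑ j, (if i = z then Rd d z j * (((w z : ℤ) ^ 2 - w z) * w' j) else 0)
        = ∑ j, Rd d z j * (((w z : ℤ) ^ 2 - w z) * w' j) := by
      rw [Finset.sum_comm]; simp
    have s2 : ∑ i, ∑ j, (if j = z then Rd d i z * (((w' i : ℤ) ^ 2 - w' i) * w z) else 0)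
        = ∑ i, Rd d i z * (((w' i : ℤ) ^ 2 - w' i) * w z) := by
      simp
    rw [s1, s2, ← Finset.sum_add_distrib]
    have s3 := Finset.sum_le_sum fun j (_ : j ∈ Finset.univ) => hbd j
    rw [← Finset.mul_sum] at s3
    have hf' : ((w z).choose 2 : ℤ) * (∑ i, (w' i : ℤ)) + f (∑ i, w' i) ≤ f (∑ i, w i) := by
      exact_mod_cast hf
    have : ((w z : ℤ) ^ 2 - w z) * ∑ i, (w' i : ℤ) = 2 * (((w z).choose 2 : ℤ) * (∑ i, (w' i : ℤ))) := by
      rw [← hch]; ring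
    linarith

end weights

/-- good colouring implies the exact bound -/
theorem card_le_of_coloring {n : ℕ} (G : Finset (Finset (Fin n)))
    (d : Fin n → Fin n → ZMod 3) (hd : ∀ i j, d j i = - d i j)
    (hG : ∀ e ∈ G, ∃ x y z, x ≠ y ∧ e = {x, y, z} ∧ d x y = 0 ∧ d x z = 1 ∧ d y z = 1) :
    G.card ≤ f n := by
  have h := PP_le d hd _ (fun _ => 1) rfl
  simp only [Finset.sum_const, Finset.card_univ, Fintype.card_fin, smul_eq_mul, mul_one] at h
  let S : Finset (Fin n × Fin n × Fin n) :=
    Finset.univ.filter fun t => t.1 ≠ t.2.1 ∧ d t.1 t.2.1 = 0 ∧ d t.1 t.2.2 = 1 ∧ d t.2.1 t.2.2 = 1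
  have hself : ∀ i, d i i = 0 := by
    intro i
    have h := hd i i
    revert h
    generalize d i i = a
    revert a
    decide
  have hS : PP d (fun _ => ((1 : ℕ) : ℤ)) = S.card := by
    have : (S.card : ℤ) = ∑ i, ∑ i', ∑ j,
        (if i ≠ i' ∧ d i i' = 0 ∧ d i j = 1 ∧ d i' j = 1 then (1 : ℤ) else 0) := by
      rw [Finset.card_filter]
      push_cast
      rw [Fintype.sum_prod_type]
      refine Finset.sum_congr rfl fun i _ => ?_
      rw [Fintype.sum_prod_type]
    rw [this]
    unfold PP
    rw [← Finset.sum_sub_distrib]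
    refine Finset.sum_congr rfl fun i _ => ?_
    have e : ∑ j, Rd d i j * (((1 : ℕ) : ℤ) * ((1 : ℕ) : ℤ))
        = ∑ i', ∑ j, if i = i' then Rd d i j else 0 := by
      rw [Finset.sum_comm]; simp
    rw [e, ← Finset.sum_sub_distrib]
    refine Finset.sum_congr rfl fun i' _ => ?_
    rw [← Finset.sum_sub_distrib]
    refine Finset.sum_congr rfl fun j _ => ?_
    unfold Bl Rd
    by_cases h0 : i = i'
    · subst h0
      by_cases h2 : d i j = 1 <;> simp [hself, h2]
    · by_cases h1 : d i i' = 0 <;> by_cases h2 : d i j = 1 <;> by_cases h3 : d i' j = 1 <;>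
        simp [h0, h1, h2, h3]
  have h2 : 2 * G.card ≤ S.card := by
    rw [mul_comm]
    have := Finset.card_nsmul_le_sum G (fun e => (S.filter fun t => ({t.1, t.2.1, t.2.2} : Finset (Fin n)) = e).card) 2 (by
      intro e he
      obtain ⟨x, y, z, hxy, rfl, h1, h2, h3⟩ := hG e he
      have hsub : ({(x, y, z), (y, x, z)} : Finset (Fin n × Fin n × Fin n)) ⊆
          S.filter fun t => ({t.1, t.2.1, t.2.2} : Finset (Fin n)) = {x, y, z} := by
        intro t ht
        simp only [Finset.mem_insert, Finset.mem_singleton] at ht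
        rcases ht with rfl | rfl
        · simp [S, hxy, h1, h2, h3]
        · have h1' : d y x = 0 := by rw [hd, h1]; rfl
          simp [S, hxy.symm, h1', h2, h3, Finset.insert_comm]
      have hc := Finset.card_le_card hsub
      rw [Finset.card_pair (by simp [hxy])] at hc
      exact hc)
    rw [smul_eq_mul] at this
    refine this.trans ?_
    rw [← Finset.card_biUnion]
    · apply Finset.card_le_card
      intro t
      simp only [Finset.mem_biUnion, Finset.mem_filter]
      rintro ⟨_, _, h, _⟩
      exact h
    · intro a _ b _ hab
      simp only [Function.onFun]
      rw [Finset.disjoint_left]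
      intro t h1 h2
      rw [Finset.mem_filter] at h1 h2
      exact hab (h1.2.symm.trans h2.2)
  rw [hS] at h
  have : S.card ≤ 2 * f n := by exact_mod_cast h
  omega

section walks
variable {V : Type} [DecidableEq V]

/-- tight step between ordered pairs -/
def TArc (G : Finset (Finset V)) (p q : V × V) : Prop :=
  p.2 = q.1 ∧ ({p.1, p.2, q.2} : Finset V) ∈ G

/-- tight walk of given length between ordered pairs -/
def TW (G : Finset (Finset V)) : ℕ → V × V → V × V → Prop
  | 0, p, q => p = q
  | k + 1, p, q => ∃ r, TW G k p r ∧ TArc G r q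

theorem TW_trans (G : Finset (Finset V)) {a b : ℕ} {p q r : V × V} (h1 : TW G a p q)
    (h2 : TW G b q r) : TW G (a + b) p r := by
  induction b generalizing r with
  | zero => cases h2; exact h1
  | succ b ih =>
    obtain ⟨s, hs, hsr⟩ := h2
    exact ⟨s, ih hs, hsr⟩

theorem TW_one (G : Finset (Finset V)) {p q : V × V} (h : TArc G p q) : TW G 1 p q :=
  ⟨p, rfl, h⟩

theorem TW_back (G : Finset (Finset V)) {p q : V × V} (h : TArc G p q) : TW G 2 q p := by
  obtain ⟨x, y⟩ := p
  obtain ⟨y', z⟩ := q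
  obtain ⟨h1, h2⟩ := h
  simp only at h1 h2
  subst h1
  refine ⟨(z, x), TW_one G ⟨rfl, ?_⟩, rfl, ?_⟩
  · simp only
    convert h2 using 1
    ext a; simp; tauto
  · simp only
    convert h2 using 1
    ext a; simp; tauto

theorem TW_rev (G : Finset (Finset V)) {a : ℕ} {p q : V × V} (h : TW G a p q) :
    TW G (2 * a) q p := by
  induction a generalizing q with
  | zero => cases h; exact rfl
  | succ a ih =>
    obtain ⟨s, hs, hsr⟩ := h
    have := TW_trans G (TW_back G hsr) (ih hs)
    rwa [show 2 + 2 * a = 2 * (a + 1) by ring] at this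

theorem TW_seq (G : Finset (Finset V)) {a : ℕ} {p q : V × V} (h : TW G a p q) :
    ∃ s : ℕ → V × V, s 0 = p ∧ s a = q ∧ ∀ i < a, TArc G (s i) (s (i + 1)) := by
  induction a generalizing q with
  | zero => cases h; exact ⟨fun _ => p, rfl, rfl, by simp⟩
  | succ a ih =>
    obtain ⟨r, hr, hrq⟩ := h
    obtain ⟨s, h0, ha, hs⟩ := ih hr
    refine ⟨fun i => if i ≤ a then s i else q, by simp [h0], by simp, ?_⟩
    intro i hi
    rcases Nat.lt_or_ge i a with h | h
    · simp only [show i ≤ a by omega, show i + 1 ≤ a by omega, if_true]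
      exact hs i h
    · have : i = a := by omega
      subst this
      simp [ha, hrq]

theorem pseudocycle_of_closed (G : Finset (Finset V)) {m : ℕ} (hm : 3 ≤ m) {p : V × V}
    (h : TW G m p p) : HasPseudocycle G m := by
  obtain ⟨s, h0, ha, hs⟩ := TW_seq G h
  have hper : ∀ j : ℕ, TArc G (s (j % m)) (s ((j + 1) % m)) := by
    intro j
    have hj : j % m < m := Nat.mod_lt _ (by omega)
    have h1 := hs (j % m) hj
    have : s ((j + 1) % m) = s (j % m + 1) := by
      rcases Nat.lt_or_ge (j % m + 1) m with h | h
      · rw [Nat.add_mod, Nat.mod_eq_of_lt (by omega : 1 < m), Nat.mod_eq_of_lt h]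
      · have e : j % m + 1 = m := by omega
        rw [Nat.add_mod, Nat.mod_eq_of_lt (by omega : 1 < m), e, Nat.mod_self, h0, ha]
    rw [this]; exact h1
  have : NeZero m := ⟨by omega⟩
  refine ⟨fun i => (s (i.val % m)).1, fun i => ?_⟩
  have e1 : (i + 1).val % m = (i.val + 1) % m := by
    rw [ZMod.val_add, Nat.mod_mod, ZMod.val_one_eq_one_mod, Nat.add_mod_mod]
  have e2 : (i + 2).val % m = (i.val + 1 + 1) % m := by
    have : i + 2 = i + 1 + 1 := by ring
    rw [this, ZMod.val_add, Nat.mod_mod, ZMod.val_one_eq_one_mod, Nat.add_mod_mod,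
      Nat.add_mod, e1, ← Nat.add_mod]
  simp only [e1, e2]
  have a1 := hper i.val
  have a2 := hper (i.val + 1)
  rw [← a1.1, ← a2.1]
  exact a1.2

/-- graph of tight adjacency on ordered pairs -/
def TG (G : Finset (Finset V)) : SimpleGraph (V × V) where
  Adj p q := p ≠ q ∧ (TArc G p q ∨ TArc G q p)
  symm := ⟨fun _ _ h => ⟨h.1.symm, h.2.symm⟩⟩
  loopless := ⟨fun _ h => h.1 rfl⟩

theorem TW_of_walk (G : Finset (Finset V)) {p q : V × V} (w : (TG G).Walk p q) :
    ∃ b ≤ 2 * w.length, TW G b p q := by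
  induction w with
  | nil => exact ⟨0, by simp, rfl⟩
  | cons h w ih =>
    obtain ⟨b, hb, hw⟩ := ih
    rcases h.2 with h | h
    · exact ⟨1 + b, by simp; omega, TW_trans G (TW_one G h) hw⟩
    · exact ⟨2 + b, by simp; omega, TW_trans G (TW_back G h) hw⟩

/-- bounded diameter and no short bad closed walks give a grading -/
theorem exists_grading (G : Finset (Finset V)) (L ℓ : ℕ) (hL : 6 * L + 4 ≤ ℓ)
    (hdiam : ∀ p q, (TG G).Reachable p q → (TG G).dist p q ≤ L)
    (hno : ∀ m : ℕ, 3 ≤ m → m ≤ ℓ → ¬ (3 ∣ m) → ¬ HasPseudocycle G m) :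
    ∃ g : V × V → ZMod 3, ∀ p q, p ≠ q → TArc G p q → g q = g p + 1 := by
  let rep : V × V → V × V := fun q => ((TG G).connectedComponentMk q).out
  have hrep : ∀ q, (TG G).Reachable (rep q) q := by
    intro q
    apply SimpleGraph.ConnectedComponent.exact
    exact Quot.out_eq _
  have hb : ∀ q, ∃ b ≤ 2 * L, TW G b (rep q) q := by
    intro q
    obtain ⟨w, hw⟩ := (hrep q).exists_walk_length_eq_dist
    obtain ⟨b, hb, h⟩ := TW_of_walk G w
    have := hdiam _ _ (hrep q)
    exact ⟨b, by omega, h⟩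
  choose b hbL hbW using hb
  refine ⟨fun q => (b q : ZMod 3), ?_⟩
  intro p q hpq h
  have hr : rep q = rep p := by
    have : (TG G).Adj p q := ⟨hpq, Or.inl h⟩
    simp only [rep]
    rw [SimpleGraph.ConnectedComponent.sound this.reachable]
  have hq := hbW q
  rw [hr] at hq
  have hclosed := TW_trans G (TW_trans G (TW_trans G (TW_trans G (hbW p) (TW_one G h))
    (TW_back G h)) (TW_one G h)) (TW_rev G hq)
  have hdvd : 3 ∣ b p + 1 + 2 + 1 + 2 * b q := by
    by_contra hnd
    refine hno _ (by omega) ?_ hnd (pseudocycle_of_closed G (by omega) hclosed)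
    have := hbL p
    have := hbL q
    omega
  have hz := (ZMod.natCast_eq_zero_iff (b p + 1 + 2 + 1 + 2 * b q) 3).2 hdvd
  push_cast at hz
  revert hz
  simp only
  generalize (b p : ZMod 3) = u
  generalize (b q : ZMod 3) = v
  revert u v
  decide

theorem exists_coloring (G : Finset (Finset V)) (h3 : ∀ e ∈ G, e.card = 3)
    (g : V × V → ZMod 3) (hg : ∀ p q, p ≠ q → TArc G p q → g q = g p + 1) :
    ∃ d : V → V → ZMod 3, (∀ i j, d j i = - d i j) ∧
      ∀ e ∈ G, ∃ x y z, x ≠ y ∧ e = {x, y, z} ∧ d x y = 0 ∧ d x z = 1 ∧ d y z = 1 := by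
  refine ⟨fun x y => g (y, x) - g (x, y), fun i j => by ring, ?_⟩
  have hstep : ∀ x y z : V, x ≠ y → ({x, y, z} : Finset V) ∈ G → g (y, z) = g (x, y) + 1 := by
    intro x y z hxy h
    exact hg (x, y) (y, z) (by simp [hxy]) ⟨rfl, h⟩
  intro e he
  obtain ⟨x, y, z, hxy, hxz, hyz, rfl⟩ := Finset.card_eq_three.1 (h3 e he)
  have p1 : ({x, z, y} : Finset V) = {x, y, z} := by ext a; simp; tauto
  have p2 : ({y, x, z} : Finset V) = {x, y, z} := by ext a; simp; tauto
  have p3 : ({y, z, x} : Finset V) = {x, y, z} := by ext a; simp; tauto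
  have p4 : ({z, x, y} : Finset V) = {x, y, z} := by ext a; simp; tauto
  have p5 : ({z, y, x} : Finset V) = {x, y, z} := by ext a; simp; tauto
  have a1 := hstep x y z hxy he
  have a2 := hstep y z x hyz (by rwa [p3])
  have b1 := hstep y x z hxy.symm (by rwa [p2])
  have b2 := hstep x z y hxz (by rwa [p1])
  have key : ∀ u v : ZMod 3, v - u = 0 ∨ v - u = 1 ∨ v - u = 2 := by decide
  rw [a1] at a2
  rw [b1] at b2
  have big : ∀ u v : ZMod 3,
      (v - u = 0 ∧ (u + 1 + 1) - (v + 1) = 1 ∧ (v + 1 + 1) - (u + 1) = 1) ∨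
      ((v + 1 + 1) - (u + 1) = 0 ∧ u - v = 1 ∧ (v + 1) - (u + 1 + 1) = 1) ∨
      ((v + 1) - (u + 1 + 1) = 0 ∧ (u + 1) - (v + 1 + 1) = 1 ∧ v - u = 1) := by decide
  simp only
  rcases big (g (x, y)) (g (y, x)) with h | h | h
  · refine ⟨x, y, z, hxy, rfl, ?_, ?_, ?_⟩
    · exact h.1
    · rw [a2, b1]; exact h.2.1
    · rw [a1, b2]; exact h.2.2
  · refine ⟨y, z, x, hyz, p3.symm, ?_, ?_, ?_⟩
    · rw [a1, b2]; exact h.1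
    · exact h.2.1
    · rw [a2, b1]; exact h.2.2
  · refine ⟨z, x, y, hxz.symm, p4.symm, ?_, ?_, ?_⟩
    · rw [a2, b1]; exact h.1
    · rw [a1, b2]; exact h.2.1
    · exact h.2.2

/-- codegree neighbourhood -/
def CN [Fintype V] (G : Finset (Finset V)) (x y : V) : Finset V :=
  Finset.univ.filter fun z => ({x, y, z} : Finset V) ∈ G

theorem exists_levels {X : Type} (T : SimpleGraph X) (p : X) (k : ℕ) :
    ∀ q, T.Reachable p q → T.dist p q = k → ∀ i ≤ k, ∃ r, T.Reachable p r ∧ T.dist p r = i := by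
  intro q hq hk i hi
  obtain ⟨w, hw⟩ := hq.exists_walk_length_eq_dist
  refine ⟨w.getVert i, ⟨w.take i⟩, ?_⟩
  have h1 := SimpleGraph.dist_le (w.take i)
  have h2 := SimpleGraph.dist_le (w.drop i)
  have h3 : T.dist p q ≤ T.dist p (w.getVert i) + T.dist (w.getVert i) q := by
    have r1 : T.Reachable p (w.getVert i) := ⟨w.take i⟩
    have r2 : T.Reachable (w.getVert i) q := ⟨w.drop i⟩
    obtain ⟨w1, hw1⟩ := r1.exists_walk_length_eq_dist
    obtain ⟨w2, hw2⟩ := r2.exists_walk_length_eq_dist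
    have := SimpleGraph.dist_le (w1.append w2)
    rw [SimpleGraph.Walk.length_append] at this
    omega
  simp only [SimpleGraph.Walk.take_length, SimpleGraph.Walk.drop_length] at h1 h2
  omega

theorem ball_card [Fintype V] (G : Finset (Finset V)) (h3 : ∀ e ∈ G, e.card = 3) (K : ℝ)
    (hK : 0 ≤ K)
    (hcod : ∀ x y, (CN G x y).Nonempty → K ≤ ((CN G x y).card : ℝ)) (p : V × V)
    (hp : (CN G p.1 p.2).Nonempty) :
    ∃ S : Finset (V × V), K ^ 2 ≤ (S.card : ℝ) ∧
      ∀ r ∈ S, ∃ w : (TG G).Walk p r, w.length ≤ 2 := by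
  classical
  refine ⟨(CN G p.1 p.2).biUnion fun z => (CN G p.2 z).image fun w => (z, w), ?_, ?_⟩
  · rw [Finset.card_biUnion]
    · push_cast
      have h1 : ∀ z ∈ CN G p.1 p.2, K ≤ (((CN G p.2 z).image fun w => (z, w)).card : ℝ) := by
        intro z hz
        rw [Finset.card_image_of_injective _ (fun a b h => by simpa using h)]
        apply hcod
        refine ⟨p.1, ?_⟩
        simp only [CN, Finset.mem_filter, Finset.mem_univ, true_and] at hz ⊢
        convert hz using 1
        ext a; simp; tauto
      have h2 := Finset.card_nsmul_le_sum _ _ _ h1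
      rw [nsmul_eq_mul] at h2
      have h4 := hcod _ _ hp
      nlinarith
    · intro a _ b _ hab
      simp only [Function.onFun]
      rw [Finset.disjoint_left]
      intro t h1 h2
      simp only [Finset.mem_image] at h1 h2
      obtain ⟨u, _, rfl⟩ := h1
      obtain ⟨v, _, h⟩ := h2
      exact hab (by simpa using (congrArg Prod.fst h).symm)
  · intro r hr
    simp only [Finset.mem_biUnion, Finset.mem_image, CN, Finset.mem_filter, Finset.mem_univ,
      true_and] at hr
    obtain ⟨z, hz, w, hw, rfl⟩ := hr
    have hne : ∀ a b c : V, ({a, b, c} : Finset V) ∈ G → a ≠ b := by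
      rintro a b c h rfl
      have h1 := h3 _ h
      have h2 : ({a, a, c} : Finset V).card ≤ 2 := by
        rw [Finset.insert_eq_of_mem (by simp)]; exact Finset.card_le_two
      omega
    have e1 : (TG G).Adj p (p.2, z) := by
      refine ⟨?_, Or.inl ⟨rfl, hz⟩⟩
      intro h
      exact hne _ _ _ hz (congrArg Prod.fst h)
    have e2 : (TG G).Adj (p.2, z) (z, w) := by
      refine ⟨?_, Or.inl ⟨rfl, hw⟩⟩
      intro h
      exact hne _ _ _ hw (congrArg Prod.fst h)
    exact ⟨SimpleGraph.Walk.cons e1 (SimpleGraph.Walk.cons e2 SimpleGraph.Walk.nil), by simp⟩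

theorem active_of_adj [Fintype V] (G : Finset (Finset V)) {p q : V × V} (h : (TG G).Adj p q) :
    (CN G p.1 p.2).Nonempty := by
  rcases h.2 with h | h
  · exact ⟨q.2, by simp [CN, h.2]⟩
  · refine ⟨q.1, ?_⟩
    have := h.2
    simp only [CN, Finset.mem_filter, Finset.mem_univ, true_and]
    rw [← h.1]
    convert this using 1
    ext a; simp; tauto

theorem diam_bound [Fintype V] (G : Finset (Finset V)) (h3 : ∀ e ∈ G, e.card = 3) (ε : ℝ)
    (hε : 0 < ε) (hn : 0 < Fintype.card V)
    (hcod : ∀ x y, (CN G x y).Nonempty → ε * Fintype.card V ≤ ((CN G x y).card : ℝ))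
    (T : ℕ) (hT : 1 < T * ε ^ 2) :
    ∀ p q, (TG G).Reachable p q → (TG G).dist p q ≤ 5 * T := by
  classical
  intro p q hpq
  by_contra hlt
  push Not at hlt
  have hS : ∀ t : Fin T, ∃ S : Finset (V × V), (ε * Fintype.card V) ^ 2 ≤ (S.card : ℝ) ∧
      ∀ r ∈ S, ((TG G).dist p r - 1) / 5 = t := by
    intro t
    obtain ⟨r, hr, hd⟩ := exists_levels (TG G) p _ q hpq rfl (5 * t + 3) (by omega)
    have hact : (CN G r.1 r.2).Nonempty := by
      obtain ⟨w, hw⟩ := hr.symm.exists_walk_length_eq_dist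
      rw [SimpleGraph.dist_comm, hd] at hw
      cases w with
      | nil => simp at hw
      | cons h w => exact active_of_adj G h
    obtain ⟨S, hS1, hS2⟩ := ball_card G h3 _ (by positivity) hcod r hact
    refine ⟨S, hS1, ?_⟩
    intro s hs
    obtain ⟨w, hw⟩ := hS2 s hs
    obtain ⟨u, hu⟩ := hr.exists_walk_length_eq_dist
    have h1 := SimpleGraph.dist_le (u.append w)
    have hps : (TG G).Reachable p s := ⟨u.append w⟩
    obtain ⟨v, hv⟩ := hps.exists_walk_length_eq_dist
    have h2 := SimpleGraph.dist_le (v.append w.reverse)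
    simp only [SimpleGraph.Walk.length_append, SimpleGraph.Walk.length_reverse] at h1 h2
    omega
  choose S hS1 hS2 using hS
  have hdisj : (∑ t, (S t).card) ≤ Fintype.card (V × V) := by
    rw [← Finset.card_biUnion]
    · exact Finset.card_le_univ _
    · intro a _ b _ hab
      simp only [Function.onFun]
      rw [Finset.disjoint_left]
      intro r h1 h2
      exact hab (Fin.ext ((hS2 a r h1).symm.trans (hS2 b r h2)))
  have hsum := Finset.card_nsmul_le_sum Finset.univ (fun t => ((S t).card : ℝ)) _
    (fun t _ => hS1 t)
  rw [nsmul_eq_mul, Finset.card_univ, Fintype.card_fin] at hsum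
  have h5 : (∑ t, ((S t).card : ℝ)) ≤ (Fintype.card V : ℝ) * Fintype.card V := by
    rw [Fintype.card_prod] at hdisj
    exact_mod_cast hdisj
  have hN : (0 : ℝ) < Fintype.card V := by exact_mod_cast hn
  have : (0 : ℝ) < (Fintype.card V : ℝ) ^ 2 := by positivity
  nlinarith

theorem cleaning [Fintype V] (H : Finset (Finset V)) (K : ℝ) (hK : 0 < K) :
    ∃ G ⊆ H, (∀ x y, (CN G x y).Nonempty → K ≤ ((CN G x y).card : ℝ)) ∧
      (H.card : ℝ) ≤ G.card + K * (Fintype.card V : ℝ) ^ 2 := by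
  classical
  let sh : Finset (Finset V) → Finset (V × V) := fun G =>
    Finset.univ.filter fun p => (CN G p.1 p.2).Nonempty
  obtain ⟨G, hG, hmax⟩ := Finset.exists_max_image H.powerset
    (fun G => (G.card : ℝ) - K * (sh G).card) ⟨H, by simp⟩
  rw [Finset.mem_powerset] at hG
  refine ⟨G, hG, ?_, ?_⟩
  · intro x y hxy
    by_contra hlt
    push Not at hlt
    let G' := G \ ((CN G x y).image fun z => ({x, y, z} : Finset V))
    have hG' : G' ⊆ G := Finset.sdiff_subset
    have h1 := hmax G' (Finset.mem_powerset.2 (hG'.trans hG))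
    have h2 : G.card ≤ G'.card + (CN G x y).card := by
      have a := Finset.le_card_sdiff ((CN G x y).image fun z => ({x, y, z} : Finset V)) G
      have b := Finset.card_image_le (s := CN G x y) (f := fun z => ({x, y, z} : Finset V))
      simp only [G']
      omega
    have h4 : (sh G').card + 1 ≤ (sh G).card := by
      apply Finset.card_lt_card
      rw [Finset.ssubset_iff_of_subset]
      · refine ⟨(x, y), by simp [sh, hxy], ?_⟩
        simp only [sh, Finset.mem_filter, Finset.mem_univ, true_and]
        rintro ⟨z, hz⟩
        simp only [CN, G', Finset.mem_filter, Finset.mem_univ, true_and, Finset.mem_sdiff,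
          Finset.mem_image] at hz
        exact hz.2 ⟨z, hz.1, rfl⟩
      · intro p
        simp only [sh, Finset.mem_filter, Finset.mem_univ, true_and]
        rintro ⟨z, hz⟩
        simp only [CN, Finset.mem_filter, Finset.mem_univ, true_and] at hz
        exact ⟨z, by simp [CN, hG' hz]⟩
    have h2' : (G.card : ℝ) ≤ G'.card + (CN G x y).card := by exact_mod_cast h2
    have h4' : ((sh G').card : ℝ) + 1 ≤ (sh G).card := by exact_mod_cast h4
    nlinarith
  · have h1 := hmax H (by simp)
    have h2 : ((sh H).card : ℝ) ≤ (Fintype.card V : ℝ) ^ 2 := by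
      have := Finset.card_le_univ (sh H)
      rw [Fintype.card_prod] at this
      rw [sq]
      exact_mod_cast this
    have h4 : (0 : ℝ) ≤ K * (sh G).card := by positivity
    have h5 := mul_le_mul_of_nonneg_left h2 hK.le
    linarith
end walks

/-- If `H` is a 3-uniform hypergraph on `n` vertices (`n` large) with no pseudocycle of
length `m` for any `m ≤ ℓ` (`ℓ` large) with `3 ∤ m`, then `e(H) ≤ f(n) + εn³`. -/
theorem weak_edge_bound :
    ∃ ε₀ : ℝ, 0 < ε₀ ∧ ∀ ε : ℝ, 0 < ε → ε < ε₀ →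
      ∃ ℓ₀ : ℕ, ∀ ℓ : ℕ, ℓ₀ ≤ ℓ →
        ∃ n₀ : ℕ, ∀ n : ℕ, n₀ ≤ n →
          ∀ H : Finset (Finset (Fin n)), (∀ e ∈ H, e.card = 3) →
            (∀ m : ℕ, 3 ≤ m → m ≤ ℓ → ¬ (3 ∣ m) → ¬ HasPseudocycle H m) →
            (H.card : ℝ) ≤ (f n : ℝ) + ε * (n : ℝ) ^ 3 := by
  refine ⟨1, one_pos, fun ε hε _ => ?_⟩
  obtain ⟨T, hT⟩ := exists_nat_gt (1 / ε ^ 2)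
  have hT' : 1 < T * ε ^ 2 := by
    rwa [div_lt_iff₀ (by positivity)] at hT
  refine ⟨6 * (5 * T) + 4, fun ℓ hℓ => ⟨1, fun n hn H h3 hno => ?_⟩⟩
  have hn0 : (0 : ℝ) < n := by exact_mod_cast hn
  obtain ⟨G, hGH, hcod, hcard⟩ := cleaning H (ε * n) (by positivity)
  have hG3 : ∀ e ∈ G, e.card = 3 := fun e he => h3 e (hGH he)
  have hnoG : ∀ m : ℕ, 3 ≤ m → m ≤ ℓ → ¬ (3 ∣ m) → ¬ HasPseudocycle G m := by
    rintro m h1 h2 h4 ⟨v, hv⟩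
    exact hno m h1 h2 h4 ⟨v, fun i => hGH (hv i)⟩
  have hdiam := diam_bound G hG3 ε hε (by rw [Fintype.card_fin]; omega) (by simpa using hcod) T hT'
  obtain ⟨g, hg⟩ := exists_grading G (5 * T) ℓ hℓ hdiam hnoG
  obtain ⟨d, hd, hdG⟩ := exists_coloring G hG3 g hg
  have hf : (G.card : ℝ) ≤ f n := by exact_mod_cast card_le_of_coloring G d hd hdG
  rw [Fintype.card_fin] at hcard
  have : ε * n * (n : ℝ) ^ 2 = ε * (n : ℝ) ^ 3 := by ring
  linarith
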